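/- For all indices i, j with 1 ≤ i, j ≤ L−1 and every index s with 0 ≤ s ≤ L−1, the curvature coefficient R^s_{iji}(t,α) vanishes identically; consequently Σ_{s=0}^{L−1} R^s_{iji}(t,α) g_{sj}(t,α) = 0, i.e. the sectional curvature K(X_i,X_j) of the coordinate plane spanned by X_i and X_j vanishes for all i, j ≠ 0. -/

import Mathlib

/-!
Formalization of results from "A geometric approach to equilibrium selection":
the metric, Christoffel symbols and curvature of the equilibrium manifold of a
two-consumer exchange economy with `L` goods, parametrized by
`Φ(t,α) = (p_1(t),…,p_{L−1}(t), α_1,…,α_{L−1}, w(t) − Σ_m p_m(t) α_m)`.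

Indices run over `Fin L`, where the index `0` corresponds to the coordinate
`x_0 = t` and an index `i ≠ 0` corresponds to the coordinate `x_i = α_i`
(the component `α 0` of `α : Fin L → ℝ` is never used, so `α` is just a copy
of `ℝ^{L−1}` together with an irrelevant extra coordinate).
-/

open Matrix BigOperators

noncomputable section

namespace EqSelection

variable {L : ℕ}

/-- `A(t,α) = w'(t) − Σ_{m=1}^{L−1} p_m'(t) α_m`. -/
def eqA [NeZero L] (p : Fin L → ℝ → ℝ) (w : ℝ → ℝ) (t : ℝ) (α : Fin L → ℝ) : ℝ :=
  deriv w t - ∑ m ∈ Finset.univ \ {0}, deriv (p m) t * α m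

/-- `A'(t,α) = w''(t) − Σ_{m=1}^{L−1} p_m''(t) α_m`. -/
def eqA' [NeZero L] (p : Fin L → ℝ → ℝ) (w : ℝ → ℝ) (t : ℝ) (α : Fin L → ℝ) : ℝ :=
  deriv (deriv w) t - ∑ m ∈ Finset.univ \ {0}, deriv (deriv (p m)) t * α m

/-- `B(t) = Σ_{m=1}^{L−1} (p_m'(t))²`. -/
def eqB [NeZero L] (p : Fin L → ℝ → ℝ) (t : ℝ) : ℝ :=
  ∑ m ∈ Finset.univ \ {0}, (deriv (p m) t) ^ 2

/-- `N(t) = 1 + Σ_{m=1}^{L−1} (p_m(t))²`. -/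
def eqN [NeZero L] (p : Fin L → ℝ → ℝ) (t : ℝ) : ℝ :=
  1 + ∑ m ∈ Finset.univ \ {0}, (p m t) ^ 2

/-- `C(t) = Σ_{m=1}^{L−1} p_m'(t) p_m''(t)`. -/
def eqC [NeZero L] (p : Fin L → ℝ → ℝ) (t : ℝ) : ℝ :=
  ∑ m ∈ Finset.univ \ {0}, deriv (p m) t * deriv (deriv (p m)) t

/-- `P(t) = Σ_{m=1}^{L−1} p_m(t) p_m'(t)`. -/
def eqP [NeZero L] (p : Fin L → ℝ → ℝ) (t : ℝ) : ℝ :=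
  ∑ m ∈ Finset.univ \ {0}, p m t * deriv (p m) t

/-- The induced metric matrix `g(t,α)`: `g_{00} = B + A²`, `g_{0i} = g_{i0} = −p_i A`,
`g_{ij} = p_i p_j + δ_{ij}` for `i, j ≠ 0`. -/
def gMat [NeZero L] (p : Fin L → ℝ → ℝ) (w : ℝ → ℝ) (t : ℝ) (α : Fin L → ℝ) :
    Matrix (Fin L) (Fin L) ℝ :=
  Matrix.of fun i j =>
    if i = 0 then
      if j = 0 then eqB p t + (eqA p w t α) ^ 2 else -(p j t) * eqA p w t α
    else
      if j = 0 then -(p i t) * eqA p w t α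
      else p i t * p j t + (if i = j then 1 else 0)

/-- Partial derivative with respect to the coordinate `x_k`, where `x_0 = t`
and `x_i = α_i` for `i ≠ 0`. -/
def pder [NeZero L] (k : Fin L) (f : ℝ → (Fin L → ℝ) → ℝ) (t : ℝ) (α : Fin L → ℝ) : ℝ :=
  if k = 0 then deriv (fun s => f s α) t
  else deriv (fun s => f t (Function.update α k s)) (α k)

/-- Christoffel symbol
`Γ^k_{ij} = (1/2) Σ_{h=0}^{L−1} g^{hk} (∂g_{jh}/∂x_i + ∂g_{hi}/∂x_j − ∂g_{ij}/∂x_h)`,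
written `christoffel p w i j k`.  (Here `g^{hk}` denotes the entries of the inverse
matrix of `g`, i.e. of `(gMat p w t α)⁻¹`.) -/
def christoffel [NeZero L] (p : Fin L → ℝ → ℝ) (w : ℝ → ℝ) (i j k : Fin L)
    (t : ℝ) (α : Fin L → ℝ) : ℝ :=
  (1 / 2) * ∑ h : Fin L,
    (gMat p w t α)⁻¹ h k *
      (pder i (fun t' α' => gMat p w t' α' j h) t α
        + pder j (fun t' α' => gMat p w t' α' h i) t α
        - pder h (fun t' α' => gMat p w t' α' i j) t α)

/-- Curvature coefficient
`R^s_{ijk} = Σ_{m} Γ^m_{ik} Γ^s_{jm} − Σ_{m} Γ^m_{jk} Γ^s_{im} + ∂Γ^s_{ik}/∂x_j − ∂Γ^s_{jk}/∂x_i`,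
written `curvR p w i j k s`. -/
def curvR [NeZero L] (p : Fin L → ℝ → ℝ) (w : ℝ → ℝ) (i j k s : Fin L)
    (t : ℝ) (α : Fin L → ℝ) : ℝ :=
  (∑ m : Fin L, christoffel p w i k m t α * christoffel p w j m s t α)
    - (∑ m : Fin L, christoffel p w j k m t α * christoffel p w i m s t α)
    + pder j (christoffel p w i k s) t α - pder i (christoffel p w j k s) t α

/-- The coordinate tangent vectors `Φ_i(t,α) ∈ ℝ^{2L−1}` of the parametrization
`Φ(t,α) = (p_1(t),…,p_{L−1}(t), α_1,…,α_{L−1}, w(t) − Σ_m p_m(t) α_m)`: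
`Φ_0 = (p_1',…,p_{L−1}', 0,…,0, A)`, and for `i ≠ 0` the vector `Φ_i` has entry `1`
in position `(L−1)+i` (1-indexed), entry `−p_i` in the last position and `0` elsewhere. -/
def PhiVec [NeZero L] (p : Fin L → ℝ → ℝ) (w : ℝ → ℝ) (i : Fin L)
    (t : ℝ) (α : Fin L → ℝ) : Fin (2 * L - 1) → ℝ :=
  fun j =>
    if i = 0 then
      if h : (j : ℕ) < L - 1 then deriv (p ⟨(j : ℕ) + 1, by omega⟩) t
      else if (j : ℕ) = 2 * L - 2 then eqA p w t α else 0
    else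
      if (j : ℕ) + 1 = (L - 1) + (i : ℕ) then 1
      else if (j : ℕ) = 2 * L - 2 then -(p i t) else 0

/-- The matrix `M(t,α)` of Statement 2: `M_{00} = N`, `M_{0i} = M_{i0} = p_i A`,
`M_{ii} = (N − p_i²) B + A²`, `M_{ij} = −p_i p_j B` for `i ≠ j`, `i, j ≠ 0`. -/
def invNumer [NeZero L] (p : Fin L → ℝ → ℝ) (w : ℝ → ℝ) (t : ℝ) (α : Fin L → ℝ) :
    Matrix (Fin L) (Fin L) ℝ :=
  Matrix.of fun i j =>
    if i = 0 then
      if j = 0 then eqN p t else p j t * eqA p w t α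
    else
      if j = 0 then p i t * eqA p w t α
      else if i = j then (eqN p t - (p i t) ^ 2) * eqB p t + (eqA p w t α) ^ 2
      else -(p i t * p j t * eqB p t)

/-- `∂A/∂α_k = −p_k'`. -/
lemma hasDerivAt_eqA_update [NeZero L] (p : Fin L → ℝ → ℝ) (w : ℝ → ℝ) {k : Fin L} (hk : k ≠ 0)
    (t : ℝ) (α : Fin L → ℝ) :
    HasDerivAt (fun s => eqA p w t (Function.update α k s)) (-deriv (p k) t) (α k) := by
  unfold eqA
  have hsum : HasDerivAt
      (fun s => ∑ m ∈ Finset.univ \ {0}, deriv (p m) t * Function.update α k s m)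
      (∑ m ∈ Finset.univ \ {0}, deriv (p m) t * (Pi.single k (1 : ℝ) : Fin L → ℝ) m) (α k) :=
    HasDerivAt.fun_sum fun m _ =>
      ((hasDerivAt_pi.1 (hasDerivAt_update α k (α k))) m).const_mul _
  have hval : ∑ m ∈ Finset.univ \ {0}, deriv (p m) t * (Pi.single k (1 : ℝ) : Fin L → ℝ) m
      = deriv (p k) t := by
    rw [Finset.sum_eq_single k]
    · simp
    · intro m _ hm
      simp [hm]
    · intro h
      simp [hk] at h
  rw [hval] at hsum
  exact hsum.const_sub _

/-- `∂g_{ij}/∂α_k = 0` for `i, j ≠ 0`. -/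
lemma pder_gMat_of_ne_zero [NeZero L] (p : Fin L → ℝ → ℝ) (w : ℝ → ℝ) {i j k : Fin L}
    (hi : i ≠ 0) (hj : j ≠ 0) (hk : k ≠ 0) (t : ℝ) (α : Fin L → ℝ) :
    pder k (fun t' α' => gMat p w t' α' i j) t α = 0 := by
  simp [pder, gMat, hi, hj, hk]

/-- `∂g_{j0}/∂α_k = p_j p_k'`. -/
lemma pder_gMat_zero_right [NeZero L] (p : Fin L → ℝ → ℝ) (w : ℝ → ℝ) {j k : Fin L}
    (hj : j ≠ 0) (hk : k ≠ 0) (t : ℝ) (α : Fin L → ℝ) :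
    pder k (fun t' α' => gMat p w t' α' j 0) t α = p j t * deriv (p k) t := by
  simp only [pder, gMat, hj, hk, Matrix.of_apply, if_false, if_true]
  rw [((hasDerivAt_eqA_update p w hk t α).const_mul (-(p j t))).deriv]
  ring

/-- `∂g_{0j}/∂α_k = p_j p_k'`. -/
lemma pder_gMat_zero_left [NeZero L] (p : Fin L → ℝ → ℝ) (w : ℝ → ℝ) {j k : Fin L}
    (hj : j ≠ 0) (hk : k ≠ 0) (t : ℝ) (α : Fin L → ℝ) :
    pder k (fun t' α' => gMat p w t' α' 0 j) t α = p j t * deriv (p k) t := by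
  simp only [pder, gMat, hj, hk, Matrix.of_apply, if_false, if_true]
  rw [((hasDerivAt_eqA_update p w hk t α).const_mul (-(p j t))).deriv]
  ring

/-- `∂g_{ij}/∂t = p_i' p_j + p_i p_j'` for `i, j ≠ 0`. -/
lemma pder_zero_gMat [NeZero L] (p : Fin L → ℝ → ℝ) (w : ℝ → ℝ)
    (hp : ∀ i, Differentiable ℝ (p i)) {i j : Fin L}
    (hi : i ≠ 0) (hj : j ≠ 0) (t : ℝ) (α : Fin L → ℝ) :
    pder 0 (fun t' α' => gMat p w t' α' i j) t α
      = deriv (p i) t * p j t + p i t * deriv (p j) t := by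
  simp only [pder, gMat, hi, hj, Matrix.of_apply, if_false, if_true]
  exact (((hp i t).hasDerivAt.mul (hp j t).hasDerivAt).add_const _).deriv

/-- The Christoffel symbols `Γ^k_{ij}` with `i, j ≠ 0` vanish identically. -/
lemma christoffel_eq_zero [NeZero L] (p : Fin L → ℝ → ℝ) (w : ℝ → ℝ)
    (hp : ∀ i, Differentiable ℝ (p i)) {i j : Fin L} (hi : i ≠ 0) (hj : j ≠ 0) (k : Fin L) :
    christoffel p w i j k = fun _ _ => 0 := by
  funext t α
  unfold christoffel
  rw [Finset.sum_eq_zero, mul_zero]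
  intro h _
  by_cases hh : h = 0
  · subst hh
    rw [pder_gMat_zero_right p w hj hi, pder_gMat_zero_left p w hi hj,
      pder_zero_gMat p w hp hi hj]
    ring
  · rw [pder_gMat_of_ne_zero p w hj hh hi, pder_gMat_of_ne_zero p w hh hi hj,
      pder_gMat_of_ne_zero p w hi hj hh]
    ring

theorem statement_10 (L : ℕ) [NeZero L] (hL : 2 ≤ L)
    (p : Fin L → ℝ → ℝ) (w : ℝ → ℝ)
    (hp : ∀ i, ContDiff ℝ (⊤ : ℕ∞) (p i)) (hw : ContDiff ℝ (⊤ : ℕ∞) w)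
    (hreg : ∀ t : ℝ, 0 < eqB p t ∨ deriv w t ≠ 0) :
    ∀ i j : Fin L, i ≠ 0 → j ≠ 0 →
      ∀ (t : ℝ) (α : Fin L → ℝ),
        (∀ s : Fin L, curvR p w i j i s t α = 0)
        ∧ ∑ s : Fin L, curvR p w i j i s t α * gMat p w t α s j = 0 := by
  intro i j hi hj t α
  have hd : ∀ i, Differentiable ℝ (p i) := fun i => (hp i).differentiable (by simp)
  have hR : ∀ s : Fin L, curvR p w i j i s t α = 0 := fun s => by
    simp [curvR, christoffel_eq_zero p w hd hi hi, christoffel_eq_zero p w hd hj hi, pder]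
  exact ⟨hR, by simp [hR]⟩

end EqSelection
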